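/- Let L ⊂ ℂ̂ be a Jordan curve that is the lemniscate of some rational map (i.e., L = r_0^{-1}(𝕋) for some rational map r_0). Then there exists a rational map g with L ⊆ g^{-1}(𝕋) such that for every rational map s one has L ⊆ s^{-1}(𝕋) if and only if s = Q ∘ g for some Q ∈ QFBP. -/

import Mathlib

/-! Rational maps sharing a Jordan curve lemniscate factor through a common map,
up to post-composition by a quotient of finite Blaschke products. -/

open Complex Metric Set OnePoint

/-- `r : ℂ̂ → ℂ̂` is a rational map: it is continuous and agrees with `p/q`
(for some polynomials `p, q` with `q ≠ 0`) away from the zeros of `q`. -/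
def IsRationalMap (r : OnePoint ℂ → OnePoint ℂ) : Prop :=
  Continuous r ∧ ∃ p q : Polynomial ℂ, q ≠ 0 ∧
    ∀ z : ℂ, q.eval z ≠ 0 → r (z : OnePoint ℂ) = ((p.eval z / q.eval z : ℂ) : OnePoint ℂ)

/-- The unit circle `𝕋`, viewed as a subset of the Riemann sphere. -/
def circleHat : Set (OnePoint ℂ) :=
  (fun z : ℂ => (z : OnePoint ℂ)) '' (sphere (0:ℂ) 1)

/-- A Jordan curve on the Riemann sphere: a subset homeomorphic to the circle. -/
def IsJordanCurve (L : Set (OnePoint ℂ)) : Prop :=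
  Nonempty (L ≃ₜ (sphere (0:ℂ) 1))

/-- `Q` belongs to `QFBP`: it is a rational map with `Q(𝕋) ⊆ 𝕋`, i.e. a quotient
of finite Blaschke products. -/
def IsQFBP (Q : OnePoint ℂ → OnePoint ℂ) : Prop :=
  IsRationalMap Q ∧ Q '' circleHat ⊆ circleHat


open Filter Topology

namespace LG

/-- Evaluation of a rational function. -/
noncomputable def ev (f : RatFunc ℂ) (z : ℂ) : ℂ := f.num.eval z / f.denom.eval z

lemma ev_eq (f : RatFunc ℂ) (z : ℂ) : ev f z = f.eval (RingHom.id ℂ) z := by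
  simp [ev, RatFunc.eval, Polynomial.eval₂_id]

lemma ev_C (c z : ℂ) : ev (RatFunc.C c) z = c := by simp [ev_eq]

lemma poly_ev {p : Polynomial ℂ} (hp : p ≠ 0) : ∀ᶠ z in cofinite, p.eval z ≠ 0 := by
  have := Polynomial.finite_setOfPred_isRoot hp
  simpa [Filter.eventually_cofinite, Polynomial.IsRoot] using this

lemma denom_ev (f : RatFunc ℂ) : ∀ᶠ z in cofinite, f.denom.eval z ≠ 0 :=
  poly_ev f.denom_ne_zero

lemma ev_add (f g : RatFunc ℂ) : ∀ᶠ z in cofinite, ev (f + g) z = ev f z + ev g z := by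
  filter_upwards [denom_ev f, denom_ev g] with z h1 h2
  simp only [ev_eq]
  exact RatFunc.eval_add _ _ (by simpa [Polynomial.eval₂_id] using h1)
    (by simpa [Polynomial.eval₂_id] using h2)

lemma ev_mul (f g : RatFunc ℂ) : ∀ᶠ z in cofinite, ev (f * g) z = ev f z * ev g z := by
  filter_upwards [denom_ev f, denom_ev g] with z h1 h2
  simp only [ev_eq]
  exact RatFunc.eval_mul _ _ (by simpa [Polynomial.eval₂_id] using h1)
    (by simpa [Polynomial.eval₂_id] using h2)

lemma ev_ne {f : RatFunc ℂ} (hf : f ≠ 0) : ∀ᶠ z in cofinite, ev f z ≠ 0 := by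
  filter_upwards [denom_ev f, poly_ev (RatFunc.num_ne_zero hf)] with z h1 h2
  exact div_ne_zero h2 h1

lemma ev_inv (f : RatFunc ℂ) : ∀ᶠ z in cofinite, ev f⁻¹ z = (ev f z)⁻¹ := by
  by_cases hf : f = 0
  · subst hf; simp [ev]
  filter_upwards [ev_mul f f⁻¹, ev_ne hf] with z h1 h2
  rw [mul_inv_cancel₀ hf] at h1
  have : ev 1 z = 1 := by simp [ev]
  rw [this] at h1
  exact (eq_inv_of_mul_eq_one_right h1.symm)

lemma ev_div (f g : RatFunc ℂ) : ∀ᶠ z in cofinite, ev (f / g) z = ev f z / ev g z := by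
  filter_upwards [ev_mul f g⁻¹, ev_inv g] with z h1 h2
  rw [div_eq_mul_inv, h1, h2, div_eq_mul_inv]

lemma ev_sub (f g : RatFunc ℂ) : ∀ᶠ z in cofinite, ev (f - g) z = ev f z - ev g z := by
  filter_upwards [ev_add (f - g) g] with z h1
  rw [sub_add_cancel] at h1
  rw [h1]; ring

lemma ev_poly (p : Polynomial ℂ) (z : ℂ) : ev (algebraMap _ _ p) z = p.eval z := by
  simp [ev]

lemma ev_aeval (p : Polynomial ℂ) (g : RatFunc ℂ) :
    ∀ᶠ z in cofinite, ev (Polynomial.aeval g p) z = p.eval (ev g z) := by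
  induction p using Polynomial.induction_on with
  | C a => simp [RatFunc.algebraMap_eq_C, ev_C]
  | add p q hp hq =>
    filter_upwards [hp, hq, ev_add (Polynomial.aeval g p) (Polynomial.aeval g q)] with z h1 h2 h3
    simp [h3, h1, h2]
  | monomial n a ih =>
    filter_upwards [ih, ev_mul (Polynomial.aeval g (Polynomial.C a * Polynomial.X ^ n)) g]
      with z h1 h2
    rw [pow_succ, ← mul_assoc, map_mul, Polynomial.aeval_X, h2, h1]
    simp

lemma ev_inj {l : Filter ℂ} [l.NeBot] (hl : l ≤ cofinite) {f g : RatFunc ℂ}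
    (h : ∀ᶠ z in l, ev f z = ev g z) : f = g := by
  by_contra hne
  have h1 : ∀ᶠ z in l, ev (f - g) z ≠ 0 := hl (ev_ne (sub_ne_zero.mpr hne))
  have h2 : ∀ᶠ z in l, ev (f - g) z = ev f z - ev g z := hl (ev_sub f g)
  obtain ⟨z, h, h1, h2⟩ := (h.and (h1.and h2)).exists
  apply h1
  rw [h2, h, sub_self]

/-- Rational functions whose complex conjugate along `l` is a rational function lying in `K`. -/
noncomputable def Econj (l : Filter ℂ) (hl : l ≤ cofinite)
    (K : IntermediateField ℂ (RatFunc ℂ)) : IntermediateField ℂ (RatFunc ℂ) where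
  carrier := {f | ∃ f' ∈ K, ∀ᶠ z in l, starRingEnd ℂ (ev f z) = ev f' z}
  mul_mem' := by
    rintro a b ⟨a', ha, ha'⟩ ⟨b', hb, hb'⟩
    refine ⟨a' * b', K.mul_mem ha hb, ?_⟩
    filter_upwards [ha', hb', hl (ev_mul a b), hl (ev_mul a' b')] with z h1 h2 h3 h4
    rw [h3, h4, map_mul, h1, h2]
  add_mem' := by
    rintro a b ⟨a', ha, ha'⟩ ⟨b', hb, hb'⟩
    refine ⟨a' + b', K.add_mem ha hb, ?_⟩
    filter_upwards [ha', hb', hl (ev_add a b), hl (ev_add a' b')] with z h1 h2 h3 h4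
    rw [h3, h4, map_add, h1, h2]
  algebraMap_mem' := by
    intro c
    refine ⟨algebraMap ℂ _ (starRingEnd ℂ c), K.algebraMap_mem _, ?_⟩
    simp [RatFunc.algebraMap_eq_C, ev_C]
  inv_mem' := by
    rintro a ⟨a', ha, ha'⟩
    refine ⟨a'⁻¹, K.inv_mem ha, ?_⟩
    filter_upwards [ha', hl (ev_inv a), hl (ev_inv a')] with z h1 h3 h4
    rw [h3, h4, map_inv₀, h1]

lemma mem_Econj {l : Filter ℂ} {hl : l ≤ cofinite}
    {K : IntermediateField ℂ (RatFunc ℂ)} {f : RatFunc ℂ} :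
    f ∈ Econj l hl K ↔ ∃ f' ∈ K, ∀ᶠ z in l, starRingEnd ℂ (ev f z) = ev f' z := Iff.rfl

open IntermediateField in
/-- The conjugate of a Lüroth generator is a Möbius transform of it. -/
lemma moebius {l : Filter ℂ} [l.NeBot] (hl : l ≤ cofinite) (hE : Econj l hl ⊤ ≠ ⊥) :
    ∃ h : RatFunc ℂ, Econj l hl ⊤ = ℂ⟮h⟯ ∧ (¬ ∃ c, h = RatFunc.C c) ∧
      ∃ α β γ δ : ℂ, α * δ - β * γ ≠ 0 ∧
        ∀ᶠ z in l, starRingEnd ℂ (ev h z) * (γ * ev h z + δ) = α * ev h z + β := by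
  set E := Econj l hl ⊤ with hEdef
  set h := RatFunc.Luroth.generator E with hh
  have hgen : E = ℂ⟮h⟯ := RatFunc.Luroth.eq_adjoin_generator
  refine ⟨h, hgen, RatFunc.Luroth.generator_ne_C hE, ?_⟩
  obtain ⟨h', -, hh'⟩ : h ∈ E := RatFunc.Luroth.generator_mem
  have hh'E : h' ∈ E := by
    refine ⟨h, trivial, ?_⟩
    filter_upwards [hh'] with z hz
    rw [← hz]; simp
  have hmem : h ∈ ℂ⟮h'⟯ := by
    have h1 : ℂ⟮h⟯ ≤ Econj l hl ℂ⟮h'⟯ := by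
      rw [IntermediateField.adjoin_simple_le_iff]
      exact ⟨h', mem_adjoin_simple_self _ _, hh'⟩
    rw [← hgen] at h1
    obtain ⟨f, hf, hf'⟩ := h1 hh'E
    have : h = f := by
      apply ev_inj hl
      filter_upwards [hh', hf'] with z h2 h3
      rw [← h3, ← h2]; simp
    rwa [this]
  set ψ : RatFunc ℂ →ₐ[ℂ] RatFunc ℂ :=
    E.val.comp (RatFunc.Luroth.algEquiv hE).toAlgHom with hψ
  have hψX : ψ RatFunc.X = h := by simp [hψ, hh]
  set R := (RatFunc.Luroth.algEquiv hE).symm ⟨h', hh'E⟩ with hR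
  have hψR : ψ R = h' := by simp [hψ, hR]
  have htop : ℂ⟮R⟯ = ⊤ := by
    have h2 : h ∈ (ℂ⟮R⟯).map ψ := by
      rw [IntermediateField.adjoin_map]; simpa [hψR] using hmem
    obtain ⟨x, hx, hxh⟩ := h2
    have : x = RatFunc.X := ψ.injective (hxh.trans hψX.symm)
    rw [eq_top_iff, ← RatFunc.adjoin_X, IntermediateField.adjoin_simple_le_iff, ← this]
    exact hx
  have hdeg := R.finrank_eq_max_natDegree
  rw [htop, IntermediateField.finrank_top] at hdeg
  have hn : R.num.natDegree ≤ 1 := by omega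
  have hd : R.denom.natDegree ≤ 1 := by omega
  have hcop := R.isCoprime_num_denom
  have hmain : Polynomial.aeval h R.denom * h' = Polynomial.aeval h R.num := by
    have h3 : algebraMap _ (RatFunc ℂ) R.denom * R = algebraMap _ _ R.num := by
      conv_lhs => rw [← R.num_div_denom]
      have : algebraMap _ (RatFunc ℂ) R.denom ≠ 0 := by
        simpa using R.denom_ne_zero
      simp only [RatFunc.num_div_denom]
      nth_rewrite 2 [← R.num_div_denom]
      field_simp
    have h4 := congrArg ψ h3
    rw [map_mul, hψR, ← RatFunc.aeval_X_left_eq_algebraMap,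
      ← RatFunc.aeval_X_left_eq_algebraMap, ← Polynomial.aeval_algHom_apply,
      ← Polynomial.aeval_algHom_apply, hψX] at h4
    exact h4
  obtain ⟨γ, δ, hγδ⟩ := Polynomial.exists_eq_X_add_C_of_natDegree_le_one hd
  obtain ⟨α, β, hαβ⟩ := Polynomial.exists_eq_X_add_C_of_natDegree_le_one hn
  refine ⟨α, β, γ, δ, ?_, ?_⟩
  · intro hdet
    rw [hγδ, hαβ] at hcop
    obtain ⟨u, v, huv⟩ := hcop
    rw [hγδ, hαβ] at hdeg
    by_cases hγ : γ = 0
    · by_cases hα : α = 0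
      · subst hγ hα
        simp at hdeg
      · have hδ : δ = 0 := by
          subst hγ; simpa [hα] using hdet
        have := congrArg (Polynomial.eval (-β/α)) huv
        simp [hγ, hδ] at this
        field_simp at this
        simp at this
    · have := congrArg (Polynomial.eval (-δ/γ)) huv
      simp at this
      have e1 : α * (-δ/γ) + β = 0 := by
        field_simp; linear_combination -hdet
      have e2 : γ * (-δ/γ) + δ = 0 := by field_simp; ring
      rw [e1, e2] at this
      simp at this
  · filter_upwards [hh', hl (ev_aeval R.denom h), hl (ev_aeval R.num h),
      hl (ev_mul (Polynomial.aeval h R.denom) h')] with z h1 h2 h3 h4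
    rw [hmain, h3, h2, ← h1] at h4
    have e1 : R.denom.eval (ev h z) = γ * ev h z + δ := by rw [hγδ]; simp
    have e2 : R.num.eval (ev h z) = α * ev h z + β := by rw [hαβ]; simp
    rw [e1, e2] at h4
    rw [h4]; ring

lemma hermitian {α β γ δ : ℂ} (hdet : α * δ - β * γ ≠ 0) :
    ∃ (A D : ℝ) (B : ℂ), (A ≠ 0 ∨ B ≠ 0 ∨ D ≠ 0) ∧ ∀ w : ℂ,
      starRingEnd ℂ w * (γ * w + δ) = α * w + β →
      (A : ℂ) * (w * starRingEnd ℂ w) + B * starRingEnd ℂ w + starRingEnd ℂ B * w + D = 0 := by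
  by_cases hc : γ.re ≠ 0 ∨ δ - starRingEnd ℂ α ≠ 0 ∨ β.re ≠ 0
  · refine ⟨2 * γ.re, -(2 * β.re), δ - starRingEnd ℂ α, by simpa using hc, ?_⟩
    intro w hw
    have hw' := congrArg (starRingEnd ℂ) hw
    simp only [map_mul, map_add, Complex.conj_conj] at hw'
    have e1 : ((2 * γ.re : ℝ) : ℂ) = γ + starRingEnd ℂ γ := by rw [Complex.add_conj]
    have e2 : ((-(2 * β.re) : ℝ) : ℂ) = -(β + starRingEnd ℂ β) := by
      rw [Complex.add_conj]; push_cast; ring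
    rw [e1, e2]
    simp only [map_sub, Complex.conj_conj]
    linear_combination hw + hw'
  · push Not at hc
    obtain ⟨h1, h2, h3⟩ := hc
    refine ⟨-(2 * γ.im), 2 * β.im, I * (δ + starRingEnd ℂ α), ?_, ?_⟩
    · by_contra hcon
      push Not at hcon
      obtain ⟨k1, k2, k3⟩ := hcon
      have hγ : γ = 0 := Complex.ext h1 (by simpa using k1)
      have hβ : β = 0 := Complex.ext h3 (by simpa using k3)
      have k2' : δ + starRingEnd ℂ α = 0 := by simpa using k2
      have : δ = 0 := by linear_combination (h2 + k2') / 2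
      apply hdet
      rw [hγ, this]; ring
    · intro w hw
      have hw' := congrArg (starRingEnd ℂ) hw
      simp only [map_mul, map_add, Complex.conj_conj] at hw'
      have e1 : ((-(2 * γ.im) : ℝ) : ℂ) = I * (γ - starRingEnd ℂ γ) := by
        rw [Complex.sub_conj]; push_cast; linear_combination (-2 * (γ.im : ℂ)) * Complex.I_mul_I
      have e2 : ((2 * β.im : ℝ) : ℂ) = -(I * (β - starRingEnd ℂ β)) := by
        rw [Complex.sub_conj]; push_cast; linear_combination (2 * (β.im : ℂ)) * Complex.I_mul_I
      rw [e1, e2]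
      simp only [map_mul, map_add, Complex.conj_conj, Complex.conj_I]
      linear_combination I * hw - I * hw'

open IntermediateField in
lemma unimodular_gen {l : Filter ℂ} [l.NeBot] (hl : l ≤ cofinite) (hE : Econj l hl ⊤ ≠ ⊥) :
    ∃ g : RatFunc ℂ, Econj l hl ⊤ = ℂ⟮g⟯ ∧ ∀ᶠ z in l, ‖ev g z‖ = 1 := by
  obtain ⟨h, hgen, hnc, α, β, γ, δ, hdet, hev⟩ := moebius hl hE
  obtain ⟨A, D, B, hne, hcirc⟩ := hermitian hdet
  rw [hgen]
  have hev2 := hev.mono fun z hz => hcirc _ hz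
  have hCmem : ∀ (c : ℂ) (K : IntermediateField ℂ (RatFunc ℂ)), RatFunc.C c ∈ K := fun c K => by
    rw [← RatFunc.algebraMap_eq_C]; exact K.algebraMap_mem c
  by_cases hA : A = 0
  · subst hA
    by_cases hB : B = 0
    · subst hB
      obtain ⟨z, hz⟩ := hev2.exists
      simp at hz hne
      exact absurd hz hne
    set u : RatFunc ℂ := RatFunc.C (starRingEnd ℂ B) * h + RatFunc.C (D / 2 : ℂ) with hu
    have hBc : RatFunc.C (starRingEnd ℂ B) ≠ 0 := by simpa using hB
    have huev : ∀ᶠ z in l, ev u z = starRingEnd ℂ B * ev h z + D / 2 := by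
      filter_upwards [hl (ev_add (RatFunc.C (starRingEnd ℂ B) * h) (RatFunc.C (D / 2 : ℂ))),
        hl (ev_mul (RatFunc.C (starRingEnd ℂ B)) h)] with z h1 h2
      rw [hu, h1, h2, ev_C, ev_C]
    have hure : ∀ᶠ z in l, (ev u z).re = 0 := by
      filter_upwards [huev, hev2] with z h1 h2
      have : ev u z + starRingEnd ℂ (ev u z) = 0 := by
        rw [h1]
        simp only [map_add, map_mul, Complex.conj_conj, map_div₀, Complex.conj_ofReal, map_ofNat]
        simp at h2
        linear_combination h2
      rw [Complex.add_conj] at this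
      have h3 : (2 * (ev u z).re : ℝ) = 0 := by exact_mod_cast this
      linarith
    have hu1 : u - 1 ≠ 0 := by
      intro h0
      have : u = 1 := sub_eq_zero.mp h0
      obtain ⟨z, hz⟩ := hure.exists
      rw [this] at hz
      simp [ev] at hz
    refine ⟨(u + 1) / (u - 1), ?_, ?_⟩
    · have hgu : h = (u - RatFunc.C (D / 2 : ℂ)) / RatFunc.C (starRingEnd ℂ B) := by
        rw [hu]; field_simp; ring
      have hug : u = ((u + 1) / (u - 1) + 1) / ((u + 1) / (u - 1) - 1) := by
        have : (u + 1) / (u - 1) - 1 = 2 / (u - 1) := by field_simp; ring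
        rw [this]
        field_simp
        ring
      apply le_antisymm
      · rw [adjoin_simple_le_iff]
        set g := (u + 1) / (u - 1) with hg
        have hgm : g ∈ ℂ⟮g⟯ := mem_adjoin_simple_self _ _
        have hum : u ∈ ℂ⟮g⟯ := by
          rw [hug]
          exact div_mem (add_mem hgm (one_mem _)) (sub_mem hgm (one_mem _))
        rw [hgu]
        exact div_mem (sub_mem hum (hCmem _ _)) (hCmem _ _)
      · rw [adjoin_simple_le_iff]
        have hum : u ∈ ℂ⟮h⟯ :=
          add_mem (mul_mem (hCmem _ _) (mem_adjoin_simple_self _ _)) (hCmem _ _)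
        exact div_mem (add_mem hum (one_mem _)) (sub_mem hum (one_mem _))
    · filter_upwards [hure, hl (ev_div (u + 1) (u - 1)), hl (ev_add u 1), hl (ev_sub u 1)]
        with z h1 h2 h3 h4
      have e1 : ev 1 z = 1 := by simp [ev]
      rw [h2, h3, h4, e1, norm_div]
      have e2 : ‖ev u z + 1‖ = ‖ev u z - 1‖ := by
        rw [Complex.norm_def, Complex.norm_def]
        congr 1
        simp [Complex.normSq_apply, h1]
      rw [e2]
      apply div_self
      intro h0
      have := congrArg Complex.re (sub_eq_zero.mp (norm_eq_zero.mp h0))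
      simp [h1] at this
  · have hAc : (A : ℂ) ≠ 0 := by exact_mod_cast hA
    set b : ℂ := B / A with hb
    set k : ℝ := (Complex.normSq B - A * D) / A ^ 2 with hk
    have hnorm : ∀ᶠ z in l, Complex.normSq (ev h z + b) = k := by
      filter_upwards [hev2] with z hz
      have : ((Complex.normSq (ev h z + b) : ℝ) : ℂ) = (k : ℂ) := by
        rw [← Complex.mul_conj, hk]
        push_cast
        rw [← Complex.mul_conj, hb]
        simp only [map_add, map_div₀, Complex.conj_ofReal]
        field_simp
        linear_combination A * hz
      exact_mod_cast this
    have hkpos : 0 < k := by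
      by_contra hk0
      apply hnc
      refine ⟨-b, ?_⟩
      apply ev_inj hl
      filter_upwards [hnorm] with z hz
      have h0 : Complex.normSq (ev h z + b) = 0 :=
        le_antisymm (by rw [hz]; linarith) (Complex.normSq_nonneg _)
      rw [Complex.normSq_eq_zero] at h0
      rw [ev_C]
      linear_combination h0
    have hρ : ((Real.sqrt k : ℝ) : ℂ) ≠ 0 := by
      have := Real.sqrt_pos.mpr hkpos
      exact_mod_cast this.ne'
    set ρ : RatFunc ℂ := RatFunc.C ((Real.sqrt k : ℝ) : ℂ) with hρdef
    have hρ0 : ρ ≠ 0 := by simpa [hρdef] using hρ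
    refine ⟨(h + RatFunc.C b) / ρ, ?_, ?_⟩
    · apply le_antisymm
      · rw [adjoin_simple_le_iff]
        set g := (h + RatFunc.C b) / ρ with hg
        have hgm : g ∈ ℂ⟮g⟯ := mem_adjoin_simple_self _ _
        have : h = g * ρ - RatFunc.C b := by rw [hg]; field_simp; ring
        rw [this]
        exact sub_mem (mul_mem hgm (hCmem _ _)) (hCmem _ _)
      · rw [adjoin_simple_le_iff]
        exact div_mem (add_mem (mem_adjoin_simple_self _ _) (hCmem _ _)) (hCmem _ _)
    · filter_upwards [hnorm, hl (ev_div (h + RatFunc.C b) ρ), hl (ev_add h (RatFunc.C b))]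
        with z h1 h2 h3
      rw [h2, h3, hρdef, ev_C, ev_C, norm_div, Complex.norm_def, h1, Complex.norm_real,
        Real.norm_of_nonneg (Real.sqrt_nonneg _)]
      exact div_self (Real.sqrt_pos.mpr hkpos).ne'

/-- Behaviour at infinity. -/
lemma poly_lim (p : Polynomial ℂ) : ∃ c : ℂ, (p ≠ 0 → c ≠ 0) ∧
    Tendsto (fun z : ℂ => p.eval z / z ^ p.natDegree) (cocompact ℂ) (𝓝 c) := by
  refine ⟨p.leadingCoeff, by simp, ?_⟩
  have h1 : Tendsto (fun z : ℂ => p.reverse.eval z⁻¹) (cocompact ℂ) (𝓝 (p.reverse.eval 0)) := by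
    rw [← Metric.cobounded_eq_cocompact]
    exact (p.reverse.continuous.tendsto 0).comp tendsto_inv₀_cobounded
  have h2 : p.reverse.eval 0 = p.leadingCoeff := by
    rw [← Polynomial.coeff_zero_eq_eval_zero, Polynomial.coeff_zero_reverse]
  rw [h2] at h1
  refine h1.congr' ?_
  have h0 : ∀ᶠ z : ℂ in cocompact ℂ, z ≠ 0 := by
    have : {(0 : ℂ)}ᶜ ∈ cocompact ℂ := isCompact_singleton.compl_mem_cocompact
    exact this
  filter_upwards [h0] with z hz
  let _ := invertibleOfNonzero hz
  have := Polynomial.eval₂_reverse_mul_pow (RingHom.id ℂ) z p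
  rw [Polynomial.eval₂_id, Polynomial.eval₂_id, invOf_eq_inv] at this
  rw [← this]
  field_simp

lemma tendsto_infty_of_norm {X : Type*} {l : Filter X} {f : X → ℂ}
    (h : Tendsto (fun x => ‖f x‖) l atTop) :
    Tendsto (fun x => (f x : OnePoint ℂ)) l (𝓝 (∞ : OnePoint ℂ)) := by
  have h1 : Tendsto f l (coclosedCompact ℂ) := by
    rw [coclosedCompact_eq_cocompact, ← Metric.cobounded_eq_cocompact]
    exact tendsto_norm_atTop_iff_cobounded.mp h
  exact OnePoint.tendsto_coe_infty.comp h1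

lemma ratio_lim (p q : Polynomial ℂ) (hp : p ≠ 0) (hq : q ≠ 0) : ∃ a : OnePoint ℂ,
    Tendsto (fun z : ℂ => ((p.eval z / q.eval z : ℂ) : OnePoint ℂ)) (cocompact ℂ) (𝓝 a) := by
  obtain ⟨c, hc0, hc⟩ := poly_lim p
  obtain ⟨d, hd0, hd⟩ := poly_lim q
  have hr := hc.div hd (hd0 hq)
  have h0 : ∀ᶠ z : ℂ in cocompact ℂ, z ≠ 0 := by
    have : {(0 : ℂ)}ᶜ ∈ cocompact ℂ := isCompact_singleton.compl_mem_cocompact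
    exact this
  rcases le_or_gt p.natDegree q.natDegree with hle | hlt
  · obtain ⟨k, hk⟩ := Nat.exists_eq_add_of_le hle
    have hpow : ∃ e : ℂ, Tendsto (fun z : ℂ => (z⁻¹) ^ k) (cocompact ℂ) (𝓝 e) := by
      refine ⟨0 ^ k, ?_⟩
      rw [← Metric.cobounded_eq_cocompact]
      exact tendsto_inv₀_cobounded.pow k
    obtain ⟨e, he⟩ := hpow
    refine ⟨((c / d * e : ℂ) : OnePoint ℂ), ?_⟩
    refine (OnePoint.continuous_coe.tendsto _).comp ?_
    refine (hr.mul he).congr' ?_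
    filter_upwards [h0] with z hz
    simp only [Pi.div_apply]
    rw [hk, pow_add, inv_pow]
    field_simp
  · obtain ⟨k, hk⟩ := Nat.exists_eq_add_of_lt hlt
    refine ⟨∞, tendsto_infty_of_norm ?_⟩
    have h1 : Tendsto (fun z : ℂ => ‖z‖ ^ (k + 1)) (cocompact ℂ) atTop :=
      (tendsto_pow_atTop (by omega)).comp (tendsto_norm_cocompact_atTop)
    have h2 := h1.atTop_mul_pos (norm_pos_iff.mpr (div_ne_zero (hc0 hp) (hd0 hq))) hr.norm
    refine h2.congr' ?_
    filter_upwards [h0] with z hz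
    simp only [Pi.div_apply]
    rw [← norm_pow, ← norm_mul]
    congr 1
    rw [hk, add_assoc, pow_add]
    field_simp
    ring

lemma exists_map (f : RatFunc ℂ) : ∃ r : OnePoint ℂ → OnePoint ℂ, IsRationalMap r ∧
    ∀ z : ℂ, f.denom.eval z ≠ 0 → r z = ((ev f z : ℂ) : OnePoint ℂ) := by
  classical
  by_cases hf : f = 0
  · subst hf
    refine ⟨fun _ => ((0 : ℂ) : OnePoint ℂ), ⟨continuous_const, 0, 1, by simp, by simp⟩, ?_⟩
    intro z _
    simp [ev]
  obtain ⟨a, ha⟩ := ratio_lim f.num f.denom (RatFunc.num_ne_zero hf) f.denom_ne_zero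
  have hcop := f.isCoprime_num_denom
  set r : OnePoint ℂ → OnePoint ℂ := fun x => x.elim a fun z =>
    if f.denom.eval z = 0 then ∞ else ((f.num.eval z / f.denom.eval z : ℂ) : OnePoint ℂ) with hr
  have hrz : ∀ z : ℂ, r z = if f.denom.eval z = 0 then ∞ else
    ((f.num.eval z / f.denom.eval z : ℂ) : OnePoint ℂ) := fun z => rfl
  have hev : ∀ z : ℂ, f.denom.eval z ≠ 0 →
      r z = ((f.num.eval z / f.denom.eval z : ℂ) : OnePoint ℂ) := by
    intro z hz; rw [hrz, if_neg hz]
  refine ⟨r, ⟨?_, f.num, f.denom, f.denom_ne_zero, hev⟩, hev⟩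
  rw [OnePoint.continuous_iff]
  constructor
  · rw [coclosedCompact_eq_cocompact]
    have : r ∞ = a := rfl
    rw [this]
    refine ha.congr' ?_
    have h0 : ∀ᶠ z : ℂ in cocompact ℂ, f.denom.eval z ≠ 0 :=
      cocompact_le_cofinite (denom_ev f)
    filter_upwards [h0] with z hz
    exact (hev z hz).symm
  · rw [continuous_iff_continuousAt]
    intro z
    by_cases hz : f.denom.eval z = 0
    · have hn : f.num.eval z ≠ 0 := by
        intro hn
        obtain ⟨u, v, huv⟩ := hcop
        have := congrArg (Polynomial.eval z) huv
        simp [hn, hz] at this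
      rw [continuousAt_iff_punctured_nhds]
      have e : r z = ∞ := by rw [hrz, if_pos hz]
      change Tendsto _ _ (𝓝 (r z))
      rw [e]
      have h0 : ∀ᶠ w in 𝓝[≠] z, f.denom.eval w ≠ 0 :=
        nhdsNE_le_cofinite z (denom_ev f)
      have h1 : Tendsto (fun w => ‖f.denom.eval w‖⁻¹) (𝓝[≠] z) atTop := by
        apply tendsto_inv_nhdsGT_zero.comp
        rw [tendsto_nhdsWithin_iff]
        constructor
        · have := (f.denom.continuous.norm.tendsto z).mono_left (nhdsWithin_le_nhds (s := {z}ᶜ))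
          simpa [hz] using this
        · filter_upwards [h0] with w hw
          simpa using hw
      have h2 := (f.num.continuous.norm.tendsto z).mono_left (nhdsWithin_le_nhds (s := {z}ᶜ))
      have h3 := h1.atTop_mul_pos (norm_pos_iff.mpr hn) h2
      refine (tendsto_infty_of_norm (f := fun w => f.num.eval w / f.denom.eval w) ?_).congr' ?_
      · refine h3.congr fun w => ?_
        rw [norm_div, div_eq_inv_mul]
      · filter_upwards [h0] with w hw
        exact (hev w hw).symm
    · have h0 : ∀ᶠ w in 𝓝 z, f.denom.eval w ≠ 0 :=
        f.denom.continuous.continuousAt.eventually_ne hz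
      have h1 : ContinuousAt (fun w => ((f.num.eval w / f.denom.eval w : ℂ) : OnePoint ℂ)) z := by
        refine OnePoint.continuous_coe.continuousAt.comp ?_
        exact f.num.continuous.continuousAt.div f.denom.continuous.continuousAt hz
      refine h1.congr ?_
      filter_upwards [h0] with w hw
      exact (hev w hw).symm

lemma to_ratFunc {r : OnePoint ℂ → OnePoint ℂ} (hr : IsRationalMap r) :
    ∃ f : RatFunc ℂ, ∀ᶠ z : ℂ in cofinite, r z = ((ev f z : ℂ) : OnePoint ℂ) := by
  obtain ⟨-, p, q, hq, h⟩ := hr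
  refine ⟨algebraMap _ _ p / algebraMap _ _ q, ?_⟩
  filter_upwards [poly_ev hq, ev_div (algebraMap _ (RatFunc ℂ) p) (algebraMap _ _ q)] with z h1 h2
  rw [h2, h z h1, ev_poly, ev_poly]

lemma eq_of_ev {r s : OnePoint ℂ → OnePoint ℂ} (hr : Continuous r) (hs : Continuous s)
    (h : ∀ᶠ z : ℂ in cofinite, r z = s z) : r = s := by
  have h1 : ∀ z : ℂ, r z = s z := by
    have hd : Dense {z : ℂ | r z = s z} := by
      have : {z : ℂ | r z = s z}ᶜ.Finite := h
      have := this.countable.dense_compl ℂ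
      simpa using this
    have := Continuous.ext_on hd (hr.comp OnePoint.continuous_coe)
      (hs.comp OnePoint.continuous_coe) (fun z hz => hz)
    exact fun z => congrFun this z
  refine Continuous.ext_on (OnePoint.denseRange_coe (X := ℂ)) hr hs ?_
  rintro _ ⟨z, rfl⟩
  exact h1 z

lemma coe_mem_circle {z : ℂ} : (z : OnePoint ℂ) ∈ circleHat ↔ ‖z‖ = 1 := by
  simp [circleHat]

lemma isClosed_circle : IsClosed circleHat := by
  have : IsCompact circleHat := (isCompact_sphere (0:ℂ) 1).image OnePoint.continuous_coe
  exact this.isClosed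

lemma sphere_perfect (x : sphere (0:ℂ) 1) : (𝓝[≠] x).NeBot := by
  have : Nontrivial (sphere (0:ℂ) 1) :=
    ⟨⟨1, by simp⟩, ⟨-1, by simp⟩, by simp [Subtype.ext_iff]; norm_num⟩
  have : ConnectedSpace (sphere (0:ℂ) 1) :=
    Subtype.connectedSpace (isConnected_sphere (by rw [Complex.rank_real_complex]; norm_num) 0 zero_le_one)
  infer_instance

lemma curve_dense {L : Set (OnePoint ℂ)} (hL : IsJordanCurve L) {A : Set (OnePoint ℂ)}
    (hA : A.Finite) : L ⊆ closure (L \ A) := by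
  obtain ⟨φ⟩ := hL
  have hperf : ∀ x : L, (𝓝[≠] x).NeBot := by
    intro x
    have hs := sphere_perfect (φ x)
    rw [← mem_closure_iff_nhdsWithin_neBot] at hs ⊢
    have := φ.symm.image_closure {φ x}ᶜ
    have h2 : x ∈ φ.symm '' closure {φ x}ᶜ := ⟨φ x, hs, by simp⟩
    rw [this] at h2
    refine closure_mono ?_ h2
    rintro _ ⟨y, hy, rfl⟩ hxy
    apply hy
    simp at hxy
    simp [← hxy]
  intro x hx
  have hd : Dense ((Subtype.val ⁻¹' A : Set L)ᶜ) := by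
    have hfin : (Subtype.val ⁻¹' A : Set L).Finite := hA.preimage Subtype.val_injective.injOn
    have := (dense_univ (X := L)).sdiff_finite hfin
    rwa [← compl_eq_univ_sdiff] at this
  have h1 := image_closure_subset_closure_image (s := (Subtype.val ⁻¹' A : Set L)ᶜ)
    (continuous_subtype_val (p := fun x => x ∈ L))
  refine closure_mono ?_ (h1 ⟨⟨x, hx⟩, hd _, rfl⟩)
  rintro _ ⟨y, hy, rfl⟩
  exact ⟨y.2, hy⟩

/-- Polynomials on the unit circle. -/
lemma circle_poly (p q : Polynomial ℂ) {S : Set ℂ} (hS : S.Infinite)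
    (hS1 : ∀ w ∈ S, ‖w‖ = 1 ∧ ‖p.eval w‖ = ‖q.eval w‖) :
    ∀ w : ℂ, ‖w‖ = 1 → ‖p.eval w‖ = ‖q.eval w‖ := by
  set n := max p.natDegree q.natDegree with hn
  have key : ∀ f : Polynomial ℂ, f.natDegree ≤ n → ∀ w : ℂ, ‖w‖ = 1 →
      (f * Polynomial.reflect n (f.map (starRingEnd ℂ))).eval w = w ^ n * ((‖f.eval w‖ ^ 2 : ℝ) : ℂ) := by
    intro f hf w hw
    have hw0 : w ≠ 0 := by rintro rfl; simp at hw
    have hwi : starRingEnd ℂ w = w⁻¹ := (Complex.inv_eq_conj hw).symm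
    have hci : starRingEnd ℂ w ≠ 0 := by simpa using hw0
    let _ := invertibleOfNonzero hci
    have := Polynomial.eval₂_reflect_mul_pow (RingHom.id ℂ) (starRingEnd ℂ w) n
      (f.map (starRingEnd ℂ)) (by simpa using hf)
    rw [Polynomial.eval₂_id, Polynomial.eval₂_id, invOf_eq_inv, Polynomial.eval_map_apply, hwi,
      inv_inv] at this
    rw [Polynomial.eval_mul]
    push_cast
    rw [← Complex.mul_conj', ← this, inv_pow]
    field_simp
  have hzero : p * Polynomial.reflect n (p.map (starRingEnd ℂ))
      - q * Polynomial.reflect n (q.map (starRingEnd ℂ)) = 0 := by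
    refine Polynomial.eq_zero_of_infinite_isRoot _ (hS.mono ?_)
    intro w hw
    obtain ⟨h1, h2⟩ := hS1 w hw
    simp only [mem_ofPred_eq, Polynomial.IsRoot, Polynomial.eval_sub]
    rw [key p (le_max_left _ _) w h1, key q (le_max_right _ _) w h1, h2, sub_self]
  intro w hw
  have := congrArg (Polynomial.eval w) hzero
  rw [Polynomial.eval_sub, key p (le_max_left _ _) w hw, key q (le_max_right _ _) w hw,
    Polynomial.eval_zero, ← mul_sub] at this
  have hw0 : w ≠ 0 := by rintro rfl; simp at hw
  have h3 := (mul_eq_zero.mp this).resolve_left (pow_ne_zero _ hw0)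
  have h4 : ‖p.eval w‖ ^ 2 = ‖q.eval w‖ ^ 2 := by
    have := sub_eq_zero.mp h3
    exact_mod_cast this
  exact (sq_eq_sq₀ (norm_nonneg _) (norm_nonneg _)).mp h4

lemma tendsto_ev {g : RatFunc ℂ} (hg : ¬ ∃ c, g = RatFunc.C c) :
    Tendsto (ev g) cofinite cofinite := by
  rw [Tendsto, le_cofinite_iff_eventually_ne]
  intro w
  rw [eventually_map]
  have hne : g - RatFunc.C w ≠ 0 := fun h => hg ⟨w, sub_eq_zero.mp h⟩
  filter_upwards [ev_ne hne, ev_sub g (RatFunc.C w)] with z h1 h2 h3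
  rw [h2, ev_C, h3, sub_self] at h1
  exact h1 rfl

lemma mem_E {l : Filter ℂ} (hl : l ≤ cofinite) {f : RatFunc ℂ}
    (hf : ∀ᶠ z in l, ‖ev f z‖ = 1) : f ∈ Econj l hl ⊤ := by
  refine ⟨f⁻¹, trivial, ?_⟩
  filter_upwards [hf, hl (ev_inv f)] with z h1 h2
  rw [h2, Complex.inv_eq_conj h1]

open IntermediateField in
theorem main (L : Set (OnePoint ℂ)) (hL : IsJordanCurve L) :
    ∃ g : OnePoint ℂ → OnePoint ℂ, IsRationalMap g ∧ L ⊆ g ⁻¹' circleHat ∧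
      ∀ s : OnePoint ℂ → OnePoint ℂ, IsRationalMap s →
        (L ⊆ s ⁻¹' circleHat ↔ ∃ Q : OnePoint ℂ → OnePoint ℂ, IsQFBP Q ∧ s = Q ∘ g) := by
  have hLne : L.Nonempty := by
    obtain ⟨φ⟩ := hL
    exact ⟨_, (φ.symm ⟨1, by simp⟩).2⟩
  set l : Filter ℂ := cofinite ⊓ 𝓟 {z : ℂ | (z : OnePoint ℂ) ∈ L} with hldef
  have hl : l ≤ cofinite := inf_le_left
  have hdense : ∀ P : OnePoint ℂ → Prop, IsClosed {x | P x} → (∀ᶠ z : ℂ in l, P z) →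
      ∀ x ∈ L, P x := by
    intro P hP hev x hx
    rw [hldef, eventually_inf_principal, eventually_cofinite] at hev
    have hfin := (hev.image (fun z : ℂ => (z : OnePoint ℂ))).union (Set.finite_singleton ∞)
    have hx' := curve_dense hL hfin hx
    refine closure_minimal ?_ hP hx'
    rintro y ⟨hyL, hyA⟩
    induction y using OnePoint.rec with
    | infty => exact absurd (Or.inr rfl) hyA
    | coe z =>
      by_contra hPz
      exact hyA (Or.inl ⟨z, fun h => hPz (h hyL), rfl⟩)
  have hnb : l.NeBot := by
    refine ⟨fun hbot => ?_⟩
    obtain ⟨x, hx⟩ := hLne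
    have := hdense (fun _ => False) (by simp) (by rw [hbot]; exact eventually_bot) x hx
    exact this
  have hLZ : ∀ᶠ z : ℂ in l, (z : OnePoint ℂ) ∈ L := by
    rw [hldef, eventually_inf_principal]; exact Eventually.of_forall fun z hz => hz
  have hback : ∀ (g : OnePoint ℂ → OnePoint ℂ), L ⊆ g ⁻¹' circleHat →
      ∀ s : OnePoint ℂ → OnePoint ℂ,
      (∃ Q : OnePoint ℂ → OnePoint ℂ, IsQFBP Q ∧ s = Q ∘ g) → L ⊆ s ⁻¹' circleHat := by
    rintro g hg s ⟨Q, hQ, rfl⟩ x hx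
    exact hQ.2 ⟨g x, hg hx, rfl⟩
  have huni : ∀ s : OnePoint ℂ → OnePoint ℂ, L ⊆ s ⁻¹' circleHat → ∀ f : RatFunc ℂ,
      (∀ᶠ z : ℂ in cofinite, s z = ((ev f z : ℂ) : OnePoint ℂ)) → ∀ᶠ z in l, ‖ev f z‖ = 1 := by
    intro s hs f hf
    filter_upwards [hLZ, hl hf] with z h1 h2
    have h3 := hs h1
    rw [mem_preimage, h2, coe_mem_circle] at h3
    exact h3
  by_cases hE : Econj l hl ⊤ = ⊥
  · have hg1 : L ⊆ (fun _ : OnePoint ℂ => ((1 : ℂ) : OnePoint ℂ)) ⁻¹' circleHat := by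
      intro x _
      rw [mem_preimage, coe_mem_circle]; simp
    refine ⟨fun _ => ((1 : ℂ) : OnePoint ℂ), ⟨continuous_const, 1, 1, by simp, by simp⟩, hg1, ?_⟩
    intro s hs
    refine ⟨fun hsL => ?_, hback _ hg1 s⟩
    obtain ⟨f, hf⟩ := to_ratFunc hs
    have hfE := mem_E hl (huni s hsL f hf)
    rw [hE, IntermediateField.mem_bot] at hfE
    obtain ⟨c, hc⟩ := hfE
    have hsc : s = fun _ => (c : OnePoint ℂ) := by
      refine eq_of_ev hs.1 continuous_const ?_
      filter_upwards [hf] with z hz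
      rw [hz, ← hc, RatFunc.algebraMap_eq_C, ev_C]
    refine ⟨s, ⟨hs, ?_⟩, ?_⟩
    · rintro _ ⟨y, _, rfl⟩
      obtain ⟨x, hx⟩ := hLne
      have := hsL hx
      rw [mem_preimage, hsc] at this
      rw [hsc]; exact this
    · rw [hsc]; rfl
  · obtain ⟨G, hGE, hG1⟩ := unimodular_gen hl hE
    obtain ⟨g, hg, hgG⟩ := exists_map G
    have hgG' : ∀ᶠ z : ℂ in cofinite, g z = ((ev G z : ℂ) : OnePoint ℂ) :=
      (denom_ev G).mono fun z hz => hgG z hz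
    have hgL : L ⊆ g ⁻¹' circleHat := by
      refine hdense (fun x => g x ∈ circleHat) (isClosed_circle.preimage hg.1) ?_
      filter_upwards [hl hgG', hG1] with z h1 h2
      rw [h1, coe_mem_circle]; exact h2
    have hGnc : ¬ ∃ c, G = RatFunc.C c := by
      rintro ⟨c, rfl⟩
      apply hE
      rw [hGE, adjoin_simple_eq_bot_iff, IntermediateField.mem_bot]
      exact ⟨c, by rw [RatFunc.algebraMap_eq_C]⟩
    have hten := tendsto_ev hGnc
    refine ⟨g, hg, hgL, fun s hs => ⟨fun hsL => ?_, hback g hgL s⟩⟩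
    obtain ⟨f, hf⟩ := to_ratFunc hs
    have hf1 := huni s hsL f hf
    have hfE := mem_E hl hf1
    rw [hGE, mem_adjoin_simple_iff] at hfE
    obtain ⟨p, t, hpt⟩ := hfE
    set F : RatFunc ℂ := algebraMap _ _ p / algebraMap _ _ t with hF
    obtain ⟨Q, hQ, hQF⟩ := exists_map F
    have hcomp : ∀ᶠ z : ℂ in cofinite, ev f z = ev F (ev G z) := by
      filter_upwards [ev_div (Polynomial.aeval G p) (Polynomial.aeval G t), ev_aeval p G,
        ev_aeval t G, hten.eventually (ev_div (algebraMap _ (RatFunc ℂ) p) (algebraMap _ _ t))]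
        with z h1 h2 h3 h4
      rw [hF, h4, hpt, h1, h2, h3, ev_poly, ev_poly]
    have hcirc : ∀ w : ℂ, ‖w‖ = 1 → ‖F.num.eval w‖ = ‖F.denom.eval w‖ := by
      refine circle_poly F.num F.denom
        (S := {w | ‖w‖ = 1 ∧ ‖F.num.eval w‖ = ‖F.denom.eval w‖}) ?_ (fun w hw => hw)
      intro hfin
      have h1 : ∀ᶠ z in l, ev G z ∉ {w | ‖w‖ = 1 ∧ ‖F.num.eval w‖ = ‖F.denom.eval w‖} :=
        hl (hten.eventually hfin.eventually_cofinite_notMem)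
      obtain ⟨z, h1, h2, h3, h4, h5⟩ := (h1.and (hG1.and (hf1.and
        ((show ∀ᶠ z in l, ev f z = ev F (ev G z) from hl hcomp).and
        (show ∀ᶠ z in l, F.denom.eval (ev G z) ≠ 0 from
          hl (hten.eventually (denom_ev F))))))).exists
      refine h1 ⟨h2, ?_⟩
      rw [h4, ev, norm_div] at h3
      exact (div_eq_one_iff_eq (norm_ne_zero_iff.mpr h5)).mp h3
    refine ⟨Q, ⟨hQ, ?_⟩, ?_⟩
    · rintro _ ⟨_, ⟨w, hw, rfl⟩, rfl⟩
      have hw1 : ‖w‖ = 1 := by simpa using hw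
      have hd : F.denom.eval w ≠ 0 := by
        intro hd
        have hn : F.num.eval w = 0 := by
          have := hcirc w hw1
          rwa [hd, norm_zero, norm_eq_zero] at this
        obtain ⟨u, v, huv⟩ := F.isCoprime_num_denom
        have := congrArg (Polynomial.eval w) huv
        simp [hn, hd] at this
      change Q (w : OnePoint ℂ) ∈ circleHat
      rw [hQF w hd, coe_mem_circle, ev, norm_div, hcirc w hw1]
      exact div_self (norm_ne_zero_iff.mpr hd)
    · refine eq_of_ev hs.1 (hQ.1.comp hg.1) ?_
      filter_upwards [hf, hcomp, hgG', hten.eventually (denom_ev F)] with z h1 h2 h3 h4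
      rw [h1, Function.comp_apply, h3, hQF _ h4, h2]

end LG

/-- if `L ⊂ ℂ̂` is a Jordan curve which is the lemniscate
`r₀⁻¹(𝕋)` of some rational map `r₀`, then there is a rational map `g` with
`L ⊆ g⁻¹(𝕋)` such that a rational map `s` satisfies `L ⊆ s⁻¹(𝕋)` if and only if
`s = Q ∘ g` for some `Q ∈ QFBP`. -/
theorem lemniscate_generator (L : Set (OnePoint ℂ)) (hL : IsJordanCurve L)
    (r₀ : OnePoint ℂ → OnePoint ℂ) (hr₀ : IsRationalMap r₀)
    (hLr₀ : r₀ ⁻¹' circleHat = L) :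
    ∃ g : OnePoint ℂ → OnePoint ℂ, IsRationalMap g ∧ L ⊆ g ⁻¹' circleHat ∧
      ∀ s : OnePoint ℂ → OnePoint ℂ, IsRationalMap s →
        (L ⊆ s ⁻¹' circleHat ↔ ∃ Q : OnePoint ℂ → OnePoint ℂ, IsQFBP Q ∧ s = Q ∘ g) := by
  exact LG.main L hL
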